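/- arXiv:1801.04583 — 3 statements merged into one kernel-verified Lean document; each statement's English description precedes it below -/
import Mathlib

section
/- Let X be a complete CAT(0) space and let Y and Y' be nonempty closed convex subsets of X such that every point of Y is within distance δ of Y' and every point of Y' is within distance δ of Y, where 0 < δ ≤ R for some R > 0. Fix p ∈ X, let q be the footpoint of p in Y and q' the footpoint of p in Y'. Let T > 0 and suppose T < d(p,q) ≤ 2R, T < d(p,q'), and 5·√R·√δ ≤ T/2. Then the Euclidean comparison angle at p between q and q' satisfies ∠̃(q, p, q') ≤ (10·√R / (√3 · T)) · √δ. -/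
open Metric Filter

/-- A geodesic (parametrized on `[0,1]`) in a metric space. -/
def IsGeodesic {X : Type*} [MetricSpace X] (γ : ℝ → X) : Prop :=
  ∀ s ∈ Set.Icc (0:ℝ) 1, ∀ t ∈ Set.Icc (0:ℝ) 1,
    dist (γ s) (γ t) = |s - t| * dist (γ 0) (γ 1)

/-- A geodesic metric space: any two points are joined by a geodesic. -/
def GeodesicMetricSpace (X : Type*) [MetricSpace X] : Prop :=
  ∀ x y : X, ∃ γ : ℝ → X, IsGeodesic γ ∧ γ 0 = x ∧ γ 1 = y

/-- CAT(0): geodesic space in which squared distance functions are 2-convex. -/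
def Cat0 (X : Type*) [MetricSpace X] : Prop :=
  GeodesicMetricSpace X ∧
  ∀ (y : X) (γ : ℝ → X), IsGeodesic γ → ∀ t ∈ Set.Icc (0:ℝ) 1,
    dist y (γ t) ^ 2 ≤ (1 - t) * dist y (γ 0) ^ 2 + t * dist y (γ 1) ^ 2
      - t * (1 - t) * dist (γ 0) (γ 1) ^ 2

/-- A geodesically convex subset. -/
def GeoConvex {X : Type*} [MetricSpace X] (Y : Set X) : Prop :=
  ∀ γ : ℝ → X, IsGeodesic γ → γ 0 ∈ Y → γ 1 ∈ Y → ∀ t ∈ Set.Icc (0:ℝ) 1, γ t ∈ Y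

/-- A `λ`-convex function on a metric space. -/
def LambdaConvex {X : Type*} [MetricSpace X] (lam : ℝ) (F : X → ℝ) : Prop :=
  ∀ γ : ℝ → X, IsGeodesic γ → ∀ t ∈ Set.Icc (0:ℝ) 1,
    F (γ t) ≤ (1 - t) * F (γ 0) + t * F (γ 1)
      - t * (1 - t) * (lam / 2) * dist (γ 0) (γ 1) ^ 2

/-- Locally Lipschitz on a subset. -/
def LocLipschitzOn {X Y : Type*} [MetricSpace X] [MetricSpace Y] (f : X → Y) (D : Set X) : Prop :=
  ∀ t ∈ D, ∃ K : NNReal, ∃ ε > 0, LipschitzOnWith K f (D ∩ Metric.ball t ε)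

/-- The (downward) absolute gradient `|∇₋F|(x)`. -/
noncomputable def absGradient {X : Type*} [MetricSpace X] (F : X → ℝ) (x : X) : ℝ :=
  max (Filter.limsup (fun y => (F x - F y) / dist x y) (nhdsWithin x {x}ᶜ)) 0

/-- `m` is a gradient curve of `F` at time `t`. -/
def IsGradientCurveAt {X : Type*} [MetricSpace X] (F : X → ℝ) (m : ℝ → X) (t : ℝ) : Prop :=
  Filter.Tendsto (fun ε : ℝ => dist (m (t + ε)) (m t) / ε) (nhdsWithin 0 (Set.Ioi 0))
    (nhds (absGradient F (m t))) ∧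
  Filter.Tendsto (fun ε : ℝ => (F (m (t + ε)) - F (m t)) / ε) (nhdsWithin 0 (Set.Ioi 0))
    (nhds (-(absGradient F (m t)) ^ 2))

/-- Pythagorean inequality for the footpoint in a convex subset of a CAT(0) space. -/
theorem Cat0.dist_footpoint_sq_add_le {X : Type*} [MetricSpace X] (hX : Cat0 X) {Y : Set X}
    (hconv : GeoConvex Y) {p q z : X} (hqY : q ∈ Y) (hq : dist p q = Metric.infDist p Y)
    (hz : z ∈ Y) : dist p q ^ 2 + dist q z ^ 2 ≤ dist p z ^ 2 := by
  obtain ⟨γ, hγ, h0, h1⟩ := hX.1 q z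
  have le_dist : ∀ y ∈ Y, dist p q ^ 2 ≤ dist p y ^ 2 := fun y hy ↦
    pow_le_pow_left₀ dist_nonneg (hq ▸ Metric.infDist_le_dist_of_mem hy) 2
  have hE := le_dist z hz
  by_contra! hlt
  have hD : 0 < dist q z ^ 2 := by linarith
  have hqz : dist q z ≠ 0 := (pow_ne_zero_iff two_ne_zero).1 hD.ne'
  set t := (dist p q ^ 2 + dist q z ^ 2 - dist p z ^ 2) / (2 * dist q z ^ 2) with ht
  have ht0 : 0 < t := div_pos (by linarith) (by linarith)
  have ht1 : t ≤ 1 := (div_le_one (by linarith)).2 (by linarith)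
  have htD : t * dist q z ^ 2 = (dist p q ^ 2 + dist q z ^ 2 - dist p z ^ 2) / 2 := by
    rw [ht]
    field_simp
  have hmem : γ t ∈ Y := hconv γ hγ (h0 ▸ hqY) (h1 ▸ hz) t ⟨ht0.le, ht1⟩
  have hcat := hX.2 p γ hγ t ⟨ht0.le, ht1⟩
  rw [h0, h1] at hcat
  have hle := le_dist _ hmem
  have hmul : 0 ≤ t * (dist p z ^ 2 - dist p q ^ 2 - dist q z ^ 2 + t * dist q z ^ 2) := by
    linarith
  have := nonneg_of_mul_nonneg_right hmul ht0
  linarith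

/-- A point near a convex set and no farther from `p` than the footpoint of `p` is close to that
footpoint. -/
theorem Cat0.dist_footpoint_le {X : Type*} [MetricSpace X] (hX : Cat0 X) {Y : Set X}
    (hconv : GeoConvex Y) {p q w : X} (hqY : q ∈ Y) (hq : dist p q = Metric.infDist p Y)
    {δ R : ℝ} (hδ : 0 < δ) (hδR : δ ≤ R) (hw : Metric.infDist w Y ≤ δ)
    (hwq : dist p w ≤ dist p q) (hwR : dist p w ≤ 2 * R) :
    dist q w ≤ 5 * (√R * √δ) := by
  obtain ⟨z, hz, hwz⟩ := (Metric.infDist_lt_iff ⟨q, hqY⟩).1 (show Metric.infDist w Y < 3 / 2 * δ by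
    linarith)
  have hpyth := hX.dist_footpoint_sq_add_le hconv hqY hq hz
  have hpz : dist p z ≤ dist p w + 3 / 2 * δ := by linarith [dist_triangle p w z]
  have hpz2 := pow_le_pow_left₀ dist_nonneg hpz 2
  have hwq2 := pow_le_pow_left₀ dist_nonneg hwq 2
  have hs0 : 0 ≤ √R * √δ := by positivity
  have hs2 : (√R * √δ) ^ 2 = R * δ := by
    rw [mul_pow, Real.sq_sqrt (hδ.le.trans hδR), Real.sq_sqrt hδ.le]
  have hδs : δ ≤ √R * √δ := by
    refine le_of_sq_le_sq ?_ hs0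
    nlinarith
  have hqz : dist q z ≤ 3 * (√R * √δ) := by
    refine le_of_sq_le_sq ?_ (by positivity)
    have h1 : dist p w * δ ≤ 2 * R * δ := mul_le_mul_of_nonneg_right hwR hδ.le
    have h2 : δ * δ ≤ R * δ := mul_le_mul_of_nonneg_right hδR hδ.le
    nlinarith
  linarith [dist_triangle q z w, dist_comm z w]

/-- In a Euclidean triangle with two sides of length at least `T`, the angle between them is at
most `2 v / √3` when the third side has length at most `v T` with `v ≤ 1 / 2`. -/
theorem Real.arccos_law_cos_le {a b c T v : ℝ} (hT : 0 < T) (ha : T ≤ a) (hb : T ≤ b)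
    (hc : 0 ≤ c) (hcv : c ≤ v * T) (hv : v ≤ 1 / 2) :
    Real.arccos ((a ^ 2 + b ^ 2 - c ^ 2) / (2 * a * b)) ≤ 2 * v / √3 := by
  have ha0 : 0 < a := hT.trans_le ha
  have hb0 : 0 < b := hT.trans_le hb
  have hv0 : 0 ≤ v := nonneg_of_mul_nonneg_left (hc.trans hcv) hT
  have hca : c ≤ v * a := hcv.trans (mul_le_mul_of_nonneg_left ha hv0)
  have hca2 : c ^ 2 ≤ v ^ 2 * a ^ 2 := by
    rw [← mul_pow]
    exact pow_le_pow_left₀ hc hca 2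
  have hv2 : v ^ 2 ≤ 1 / 4 := by nlinarith
  have hnum : 0 ≤ a ^ 2 + b ^ 2 - c ^ 2 := by nlinarith [sq_nonneg a, sq_nonneg b]
  have hx0 : 0 ≤ (a ^ 2 + b ^ 2 - c ^ 2) / (2 * a * b) := by positivity
  have hx2 : 1 - v ^ 2 ≤ ((a ^ 2 + b ^ 2 - c ^ 2) / (2 * a * b)) ^ 2 := by
    rw [div_pow, le_div_iff₀ (by positivity)]
    have := mul_le_mul_of_nonneg_right hca2 (sq_nonneg b)
    linarith [sq_nonneg (c ^ 2 + b ^ 2 - a ^ 2)]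
  set x := (a ^ 2 + b ^ 2 - c ^ 2) / (2 * a * b)
  have h3 : 1 ≤ √3 := Real.one_le_sqrt.2 (by norm_num)
  have hK0 : 0 ≤ 2 * v / √3 := by positivity
  have hK1 : 2 * v / √3 ≤ 1 := (div_le_one (by positivity)).2 (by linarith)
  have hK2 : (2 * v / √3) ^ 2 = 4 / 3 * v ^ 2 := by
    rw [div_pow, Real.sq_sqrt (by norm_num)]
    ring
  have hcos : Real.cos (2 * v / √3) ≤ x := by
    refine (Real.cos_le_one_div_sqrt_sq_add_one (by linarith [Real.pi_gt_three])
      (by linarith [Real.pi_gt_three])).trans (le_of_sq_le_sq (le_trans ?_ hx2) hx0)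
    rw [hK2, div_pow, Real.sq_sqrt (by positivity), div_le_iff₀ (by positivity)]
    nlinarith [sq_nonneg v]
  calc Real.arccos x ≤ Real.arccos (Real.cos (2 * v / √3)) := Real.arccos_le_arccos hcos
    _ = 2 * v / √3 := Real.arccos_cos hK0 (by linarith [Real.pi_gt_three])

theorem stmt14 {X : Type*} [MetricSpace X] [CompleteSpace X] (hX : Cat0 X)
    (Y Y' : Set X) (hne : Y.Nonempty) (hne' : Y'.Nonempty)
    (hcl : IsClosed Y) (hcl' : IsClosed Y')
    (hconv : GeoConvex Y) (hconv' : GeoConvex Y')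
    (δ R : ℝ) (hδ : 0 < δ) (hδR : δ ≤ R) (hR : 0 < R)
    (hYY' : ∀ x ∈ Y, Metric.infDist x Y' ≤ δ)
    (hY'Y : ∀ x ∈ Y', Metric.infDist x Y ≤ δ)
    (p q q' : X) (hqY : q ∈ Y) (hq : dist p q = Metric.infDist p Y)
    (hq'Y : q' ∈ Y') (hq' : dist p q' = Metric.infDist p Y')
    (T : ℝ) (hT : 0 < T) (hTq : T < dist p q) (hpq : dist p q ≤ 2 * R)
    (hTq' : T < dist p q') (hsmall : 5 * Real.sqrt R * Real.sqrt δ ≤ T / 2) :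
    Real.arccos ((dist p q ^ 2 + dist p q' ^ 2 - dist q q' ^ 2) /
        (2 * dist p q * dist p q')) ≤
      10 * Real.sqrt R / (Real.sqrt 3 * T) * Real.sqrt δ := by
  have hclose : dist q q' ≤ 5 * (√R * √δ) := by
    rcases le_total (dist p q') (dist p q) with h | h
    · exact hX.dist_footpoint_le hconv hqY hq hδ hδR (hY'Y q' hq'Y) h (h.trans hpq)
    · rw [dist_comm]
      exact hX.dist_footpoint_le hconv' hq'Y hq' hδ hδR (hYY' q hqY) h hpq
  have hangle := Real.arccos_law_cos_le (v := 5 * (√R * √δ) / T) hT hTq.le hTq'.le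
    (dist_nonneg (x := q) (y := q')) (by rwa [div_mul_cancel₀ _ hT.ne'])
    (by rw [div_le_iff₀ hT]; linarith)
  refine hangle.trans_eq ?_
  field_simp
  ring
end

section
/- Let X be a complete CAT(0) space, let x₁, …, x_n ∈ X and y₁, …, y_n ∈ X, and let b be the barycenter of x₁, …, x_n and b' the barycenter of y₁, …, y_n. Then d(b, b') ≤ (1/n) · Σ_{i=1}^n d(x_i, y_i). -/
open Metric Filter

/-- Reshetnyak's quadrilateral inequality in a CAT(0) space. -/
theorem Cat0.dist_sq_add_dist_sq_le {X : Type*} [MetricSpace X] (hX : Cat0 X) (p q r s : X) :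
    dist p r ^ 2 + dist q s ^ 2 ≤
      dist p s ^ 2 + dist q r ^ 2 + 2 * dist p q * dist r s := by
  rcases eq_or_ne p q with rfl | hpq
  · simp [add_comm]
  rcases eq_or_ne r s with rfl | hrs
  · simp
  have ha : 0 < dist p q := dist_pos.2 hpq
  have hc : 0 < dist r s := dist_pos.2 hrs
  obtain ⟨γ, hγ, h0, h1⟩ := hX.1 q s
  set a := dist p q with ha'
  set c := dist r s with hc'
  have hac : 0 < a + c := add_pos ha hc
  have ht : a / (a + c) ∈ Set.Icc (0 : ℝ) 1 :=
    ⟨by positivity, (div_le_one hac).2 (by linarith)⟩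
  have hp := hX.2 p γ hγ _ ht
  have hr := hX.2 r γ hγ _ ht
  rw [h0, h1, ← ha'] at hp
  rw [h0, h1, ← hc', dist_comm r q] at hr
  set z := γ (a / (a + c))
  have htri : dist p r ≤ dist p z + dist r z := dist_triangle_right p r z
  have hsub : 1 - a / (a + c) = c / (a + c) := by field_simp; ring
  rw [hsub] at hp hr
  generalize dist p z = u at *
  generalize dist r z = v at *
  have hp2 : (a + c) * u ^ 2 ≤ c * a ^ 2 + a * dist p s ^ 2
      - a * c / (a + c) * dist q s ^ 2 := by
    calc (a + c) * u ^ 2 ≤ (a + c) * _ := mul_le_mul_of_nonneg_left hp hac.le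
      _ = _ := by field_simp
  have hr2 : (a + c) * v ^ 2 ≤ c * dist q r ^ 2 + a * c ^ 2
      - a * c / (a + c) * dist q s ^ 2 := by
    calc (a + c) * v ^ 2 ≤ (a + c) * _ := mul_le_mul_of_nonneg_left hr hac.le
      _ = _ := by field_simp
  have hpr : dist p r ^ 2 ≤ (u + v) ^ 2 := pow_le_pow_left₀ dist_nonneg htri 2
  have hcs : a * c * (u + v) ^ 2 ≤ c * ((a + c) * u ^ 2) + a * ((a + c) * v ^ 2) := by
    nlinarith [sq_nonneg (c * u - a * v)]
  have hsum : c * (a * c / (a + c) * dist q s ^ 2) + a * (a * c / (a + c) * dist q s ^ 2)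
      = a * c * dist q s ^ 2 := by field_simp; ring
  have hmul : a * c * (dist p r ^ 2 + dist q s ^ 2) ≤
      a * c * (dist p s ^ 2 + dist q r ^ 2 + 2 * a * c) := by
    have e1 := mul_le_mul_of_nonneg_left hp2 hc.le
    have e2 := mul_le_mul_of_nonneg_left hr2 ha.le
    have e3 := mul_le_mul_of_nonneg_left hpr (mul_pos ha hc).le
    linarith
  exact le_of_mul_le_mul_left hmul (mul_pos ha hc)

/-- The variance inequality for a barycenter in a CAT(0) space. -/
theorem Cat0.sum_dist_sq_add_le {X : Type*} [MetricSpace X] (hX : Cat0 X) {n : ℕ}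
    (x : Fin n → X) (b : X)
    (hb : ∀ z : X, (∑ i, dist b (x i) ^ 2) ≤ ∑ i, dist z (x i) ^ 2) (z : X) :
    (∑ i, dist b (x i) ^ 2) + n * dist b z ^ 2 ≤ ∑ i, dist z (x i) ^ 2 := by
  obtain ⟨γ, hγ, h0, h1⟩ := hX.1 b z
  have key : ∀ t ∈ Set.Icc (0 : ℝ) 1, t * ((1 - t) * (n * dist b z ^ 2)) ≤
      t * ((∑ i, dist z (x i) ^ 2) - ∑ i, dist b (x i) ^ 2) := by
    intro t ht
    have h : ∑ i, dist (γ t) (x i) ^ 2 ≤ ∑ i, ((1 - t) * dist b (x i) ^ 2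
        + t * dist z (x i) ^ 2 - t * (1 - t) * dist b z ^ 2) := by
      refine Finset.sum_le_sum fun i _ => ?_
      have := hX.2 (x i) γ hγ t ht
      rwa [h0, h1, dist_comm (x i), dist_comm (x i), dist_comm (x i)] at this
    rw [Finset.sum_sub_distrib, Finset.sum_add_distrib, ← Finset.mul_sum, ← Finset.mul_sum,
      Finset.sum_const, Finset.card_univ, Fintype.card_fin, nsmul_eq_mul] at h
    linarith [hb (γ t)]
  have hS := hb z
  by_contra! hlt
  set K := (n : ℝ) * dist b z ^ 2
  set S := (∑ i, dist z (x i) ^ 2) - ∑ i, dist b (x i) ^ 2 with hSdef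
  have hS0 : 0 ≤ S := by linarith
  have hSK : S < K := by linarith
  have hK : 0 < K := hS0.trans_lt hSK
  have ht0 : 0 < (K - S) / (2 * K) := div_pos (by linarith) (by linarith)
  have ht1 : (K - S) / (2 * K) ≤ 1 := (div_le_one (by linarith)).2 (by linarith)
  have h := le_of_mul_le_mul_left (key _ ⟨ht0.le, ht1⟩) ht0
  have heq : (1 - (K - S) / (2 * K)) * K = (K + S) / 2 := by field_simp; ring
  linarith

theorem stmt16 {X : Type*} [MetricSpace X] [CompleteSpace X] (hX : Cat0 X)
    (n : ℕ) (hn : 0 < n) (x y : Fin n → X) (b b' : X)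
    (hb : ∀ z : X, (∑ i, dist b (x i) ^ 2) ≤ ∑ i, dist z (x i) ^ 2)
    (hb' : ∀ z : X, (∑ i, dist b' (y i) ^ 2) ≤ ∑ i, dist z (y i) ^ 2) :
    dist b b' ≤ (1 / n : ℝ) * ∑ i, dist (x i) (y i) := by
  have hx := hX.sum_dist_sq_add_le x b hb b'
  have hy := hX.sum_dist_sq_add_le y b' hb' b
  have hq : ∑ i, (dist b' (x i) ^ 2 + dist b (y i) ^ 2) ≤
      ∑ i, (dist b' (y i) ^ 2 + dist b (x i) ^ 2 + 2 * dist b b' * dist (x i) (y i)) :=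
    Finset.sum_le_sum fun i _ => by
      simpa [dist_comm b' b] using hX.dist_sq_add_dist_sq_le b' b (x i) (y i)
  rw [Finset.sum_add_distrib, Finset.sum_add_distrib, Finset.sum_add_distrib,
    ← Finset.mul_sum] at hq
  rw [dist_comm b' b] at hy
  have hn' : (0 : ℝ) < n := Nat.cast_pos.2 hn
  rcases (dist_nonneg (x := b) (y := b')).eq_or_lt with h | h
  · rw [← h]
    positivity
  · have hmul : dist b b' * (n * dist b b') ≤ dist b b' * ∑ i, dist (x i) (y i) := by linarith
    rw [one_div, ← div_eq_inv_mul, le_div_iff₀' hn']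
    exact le_of_mul_le_mul_left hmul h
end

section
/- Let X be a complete CAT(0) space and let E₁, …, E_n : I → X (I ⊆ ℝ an interval) be curves with speed at most 1, i.e. d(E_i(t), E_i(t')) ≤ |t−t'| for all i and all t, t' ∈ I. Define the barycenter curve b : I → X by letting b(t) be the barycenter of E₁(t), …, E_n(t). Then b is 1-Lipschitz: d(b(t), b(t')) ≤ |t−t'| for all t, t' ∈ I. -/
open Metric Filter

/-- Quadrilateral comparison in CAT(0) spaces, with upper bounds for two opposite sides. -/
theorem Cat0.quadrilateral {X : Type*} [MetricSpace X] (hX : Cat0 X) (p q r s : X)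
    {α β : ℝ} (hα : 0 < α) (hβ : 0 < β) (hqr : dist q r ≤ α) (hps : dist p s ≤ β) :
    dist p r ^ 2 + dist q s ^ 2 ≤ dist p q ^ 2 + dist r s ^ 2 + 2 * α * β := by
  obtain ⟨γ, hγ, rfl, rfl⟩ := hX.1 p r
  have hαβ : 0 < α + β := by positivity
  have ht : β / (α + β) ∈ Set.Icc (0:ℝ) 1 :=
    ⟨by positivity, by rw [div_le_one hαβ]; linarith⟩
  have hq := hX.2 q γ hγ _ ht
  have hs := hX.2 s γ hγ _ ht
  have htri := dist_triangle_right q s (γ (β / (α + β)))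
  rw [show 1 - β / (α + β) = α / (α + β) by field_simp; ring] at hq hs
  set u := dist q (γ (β / (α + β)))
  set v := dist s (γ (β / (α + β)))
  rw [dist_comm q (γ 0)] at hq
  rw [dist_comm s (γ 0), dist_comm s (γ 1)] at hs
  have hqr2 : dist q (γ 1) ^ 2 ≤ α ^ 2 := by gcongr
  have hps2 : dist (γ 0) s ^ 2 ≤ β ^ 2 := by gcongr
  have hdiag : dist q s ^ 2 ≤ (α + β) / α * u ^ 2 + (α + β) / β * v ^ 2 := by
    have h1 : dist q s ^ 2 ≤ (u + v) ^ 2 := by gcongr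
    have h2 : (α + β) / α * u ^ 2 + (α + β) / β * v ^ 2 - (u + v) ^ 2
        = (β * u - α * v) ^ 2 / (α * β) := by field_simp; ring
    have h3 : 0 ≤ (β * u - α * v) ^ 2 / (α * β) := by positivity
    linarith
  have hq' : (α + β) / α * u ^ 2 ≤ dist (γ 0) q ^ 2 + β / α * α ^ 2
      - β / (α + β) * dist (γ 0) (γ 1) ^ 2 := by
    calc (α + β) / α * u ^ 2 ≤ _ := mul_le_mul_of_nonneg_left hq (by positivity)
      _ = dist (γ 0) q ^ 2 + β / α * dist q (γ 1) ^ 2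
          - β / (α + β) * dist (γ 0) (γ 1) ^ 2 := by field_simp
      _ ≤ _ := by gcongr
  have hs' : (α + β) / β * v ^ 2 ≤ dist (γ 1) s ^ 2 + α / β * β ^ 2
      - α / (α + β) * dist (γ 0) (γ 1) ^ 2 := by
    calc (α + β) / β * v ^ 2 ≤ _ := mul_le_mul_of_nonneg_left hs (by positivity)
      _ = dist (γ 1) s ^ 2 + α / β * dist (γ 0) s ^ 2
          - α / (α + β) * dist (γ 0) (γ 1) ^ 2 := by field_simp; ring
      _ ≤ _ := by gcongr
  have e1 : β / α * α ^ 2 = α * β := by field_simp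
  have e2 : α / β * β ^ 2 = α * β := by field_simp
  have e3 : β / (α + β) * dist (γ 0) (γ 1) ^ 2 + α / (α + β) * dist (γ 0) (γ 1) ^ 2
      = dist (γ 0) (γ 1) ^ 2 := by field_simp; ring
  linarith

/-- The variance inequality for barycenters in CAT(0) spaces. -/
theorem Cat0.variance_inequality {X : Type*} [MetricSpace X] (hX : Cat0 X)
    {ι : Type*} [Fintype ι] (e : ι → X) (b z : X)
    (hb : ∀ w : X, ∑ i, dist b (e i) ^ 2 ≤ ∑ i, dist w (e i) ^ 2) :
    Fintype.card ι * dist b z ^ 2 ≤ ∑ i, dist z (e i) ^ 2 - ∑ i, dist b (e i) ^ 2 := by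
  obtain ⟨γ, hγ, rfl, rfl⟩ := hX.1 b z
  set P : ℝ := Fintype.card ι * dist (γ 0) (γ 1) ^ 2 with hP
  set S : ℝ := ∑ i, dist (γ 1) (e i) ^ 2 - ∑ i, dist (γ 0) (e i) ^ 2 with hS
  have key : ∀ t : ℝ, 0 < t → t ≤ 1 → (1 - t) * P ≤ S := by
    intro t ht0 ht1
    have hsum : ∑ i, dist (γ t) (e i) ^ 2 ≤ ∑ i, ((1 - t) * dist (γ 0) (e i) ^ 2
        + t * dist (γ 1) (e i) ^ 2 - t * (1 - t) * dist (γ 0) (γ 1) ^ 2) := by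
      refine Finset.sum_le_sum fun i _ => ?_
      simpa only [dist_comm (e i)] using hX.2 (e i) γ hγ t ⟨ht0.le, ht1⟩
    rw [Finset.sum_sub_distrib, Finset.sum_add_distrib, ← Finset.mul_sum, ← Finset.mul_sum,
      Finset.sum_const, Finset.card_univ, nsmul_eq_mul] at hsum
    refine le_of_mul_le_mul_left ?_ ht0
    have hmin := hb (γ t)
    rw [hP, hS]
    linarith
  by_contra! hlt
  have hS0 : 0 ≤ S := sub_nonneg.2 (hb _)
  have hP0 : 0 < P := hS0.trans_lt hlt
  have h := key ((P - S) / (2 * P)) (div_pos (by linarith) (by linarith))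
    (by rw [div_le_one (by linarith)]; linarith)
  have h2 : (1 - (P - S) / (2 * P)) * P = (P + S) / 2 := by field_simp; ring
  linarith

theorem stmt17 {X : Type*} [MetricSpace X] [CompleteSpace X] (hX : Cat0 X)
    (n : ℕ) (hn : 0 < n) (I : Set ℝ) (hI : I.OrdConnected)
    (E : Fin n → ℝ → X)
    (hE : ∀ i, ∀ t ∈ I, ∀ t' ∈ I, dist (E i t) (E i t') ≤ |t - t'|)
    (b : ℝ → X)
    (hb : ∀ t ∈ I, ∀ z : X, (∑ i, dist (b t) (E i t) ^ 2) ≤ ∑ i, dist z (E i t) ^ 2) :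
    ∀ t ∈ I, ∀ t' ∈ I, dist (b t) (b t') ≤ |t - t'| := by
  intro t ht t' ht'
  rcases eq_or_ne t t' with rfl | hne
  · simp
  have hδ : 0 < |t - t'| := abs_pos.2 (sub_ne_zero.2 hne)
  rcases (dist_nonneg : 0 ≤ dist (b t) (b t')).eq_or_lt with h0 | hD
  · rw [← h0]
    exact hδ.le
  have hv := hX.variance_inequality (fun i => E i t) (b t) (b t') (hb t ht)
  have hv' := hX.variance_inequality (fun i => E i t') (b t') (b t) (hb t' ht')
  have hq : ∑ i, (dist (b t') (E i t) ^ 2 + dist (b t) (E i t') ^ 2)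
      ≤ ∑ i, (dist (b t') (E i t') ^ 2 + dist (b t) (E i t) ^ 2
        + 2 * |t - t'| * dist (b t) (b t')) := by
    refine Finset.sum_le_sum fun i _ => ?_
    have h := hX.quadrilateral (b t') (E i t') (E i t) (b t) hδ hD
      (by rw [dist_comm]; exact hE i t ht t' ht') (dist_comm _ _).le
    rwa [dist_comm (E i t') (b t), dist_comm (E i t) (b t)] at h
  simp only [Finset.sum_add_distrib, Finset.sum_const, Finset.card_univ, nsmul_eq_mul,
    Fintype.card_fin] at hq hv hv'
  rw [dist_comm (b t') (b t)] at hv'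
  have hn' : (0:ℝ) < n := Nat.cast_pos.2 hn
  refine le_of_mul_le_mul_left ?_ (mul_pos hn' hD)
  linarith
end
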